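/- Let m₁, m₂ ∈ ℝ^d and let Σ be a symmetric positive definite d×d matrix. Then the squared 2-Wasserstein distance between the Gaussian measures N(m₁, I_d) and N(m₂, Σ) equals W₂²( N(m₁, I_d), N(m₂, Σ) ) = ‖m₁ − m₂‖₂² + d + Tr(Σ) − 2 Tr(Σ^{1/2}), where Σ^{1/2} is the unique symmetric positive definite square root of Σ. -/

import Mathlib

open MeasureTheory Matrix Real

/-- The squared Euclidean norm `‖x‖₂²` on `ℝ^d`. -/
noncomputable def sqNorm {d : ℕ} (x : Fin d → ℝ) : ℝ := ∑ i, x i ^ 2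

/-- The Lebesgue density of the Gaussian `N(m, S)` on `ℝ^d`
(for `S` positive definite). -/
noncomputable def gaussianPdf {d : ℕ} (m : Fin d → ℝ) (S : Matrix (Fin d) (Fin d) ℝ)
    (x : Fin d → ℝ) : ℝ :=
  (2 * π) ^ (-(d : ℝ) / 2) * S.det ^ (-(1 : ℝ) / 2) *
    Real.exp (-(1 / 2) * ((x - m) ⬝ᵥ (S⁻¹ *ᵥ (x - m))))

/-- The multivariate Gaussian measure `N(m, S)` on `ℝ^d`, defined through its
Lebesgue density. -/
noncomputable def multivariateGaussian {d : ℕ} (m : Fin d → ℝ)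
    (S : Matrix (Fin d) (Fin d) ℝ) : Measure (Fin d → ℝ) :=
  volume.withDensity fun x => ENNReal.ofReal (gaussianPdf m S x)

/-- The squared `2`-Wasserstein distance `W₂²(ν₁, ν₂)`: the infimum over all
couplings `π` of `ν₁` and `ν₂` of `∫ ‖x − y‖₂² dπ(x,y)`. -/
noncomputable def sqWasserstein {d : ℕ} (ν₁ ν₂ : Measure (Fin d → ℝ)) : ENNReal :=
  ⨅ (cpl : Measure ((Fin d → ℝ) × (Fin d → ℝ)))
    (_ : cpl.map Prod.fst = ν₁ ∧ cpl.map Prod.snd = ν₂),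
      ∫⁻ q, ENNReal.ofReal (sqNorm (q.1 - q.2)) ∂cpl

lemma sqNorm_eq_dotProduct {d : ℕ} (x : Fin d → ℝ) : sqNorm x = x ⬝ᵥ x := by
  simp [sqNorm, dotProduct, sq]

@[fun_prop]
lemma continuous_sqNorm {d : ℕ} : Continuous (sqNorm : (Fin d → ℝ) → ℝ) := by
  unfold sqNorm
  fun_prop

lemma sqNorm_nonneg {d : ℕ} (x : Fin d → ℝ) : 0 ≤ sqNorm x :=
  Finset.sum_nonneg fun _ _ => sq_nonneg _

/-- The standard Gaussian measure on `ℝ^d`, as a product of one-dimensional Gaussians. -/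
noncomputable def stdGaussianPi (d : ℕ) : Measure (Fin d → ℝ) :=
  Measure.pi fun _ => ProbabilityTheory.gaussianReal 0 1

instance isProbabilityMeasure_stdGaussianPi (d : ℕ) : IsProbabilityMeasure (stdGaussianPi d) := by
  unfold stdGaussianPi
  infer_instance

/-- The Lebesgue density of the standard Gaussian measure is the product of its marginal
densities. -/
lemma stdGaussianPi_eq_withDensity (d : ℕ) :
    stdGaussianPi d = volume.withDensity fun x : Fin d → ℝ =>
      ENNReal.ofReal (∏ i, ProbabilityTheory.gaussianPDFReal 0 1 (x i)) := by
  refine Measure.pi_eq fun s hs => ?_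
  rw [withDensity_apply _ (MeasurableSet.univ_pi hs)]
  have hint : ∀ i : Fin d, Integrable (ProbabilityTheory.gaussianPDFReal 0 1)
      (volume.restrict (s i)) :=
    fun i => (ProbabilityTheory.integrable_gaussianPDFReal 0 1).restrict
  rw [volume_pi, Measure.restrict_pi_pi, ← ofReal_integral_eq_lintegral_ofReal
      (Integrable.fintype_prod hint)
      (.of_forall fun x => Finset.prod_nonneg fun i _ =>
        ProbabilityTheory.gaussianPDFReal_nonneg 0 1 (x i)),
    integral_fintype_prod_eq_prod (fun _ => ProbabilityTheory.gaussianPDFReal 0 1),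
    ENNReal.ofReal_prod_of_nonneg fun i _ => integral_nonneg fun x =>
      ProbabilityTheory.gaussianPDFReal_nonneg 0 1 x]
  simp_rw [ProbabilityTheory.gaussianReal_apply_eq_integral 0 one_ne_zero]

lemma prod_gaussianPDFReal_eq {d : ℕ} (x : Fin d → ℝ) :
    ∏ i, ProbabilityTheory.gaussianPDFReal 0 1 (x i)
      = (2 * π) ^ (-(d : ℝ) / 2) * Real.exp (-(1 / 2) * (x ⬝ᵥ x)) := by
  simp only [ProbabilityTheory.gaussianPDFReal, NNReal.coe_one, mul_one, sub_zero,
    Finset.prod_mul_distrib, Finset.prod_const, Finset.card_univ, Fintype.card_fin,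
    ← Real.exp_sum]
  congr 1
  · rw [Real.sqrt_eq_rpow, ← Real.rpow_neg (by positivity), ← Real.rpow_natCast,
      ← Real.rpow_mul (by positivity)]
    congr 1
    ring
  · rw [dotProduct, Finset.mul_sum]
    congr 1
    exact Finset.sum_congr rfl fun i _ => by ring

lemma gaussianPdf_affine {d : ℕ} (m : Fin d → ℝ) {R : Matrix (Fin d) (Fin d) ℝ} (hR : R.PosDef)
    (x : Fin d → ℝ) :
    gaussianPdf m (R * R) (m + R *ᵥ x)
      = R.det⁻¹ * ∏ i, ProbabilityTheory.gaussianPDFReal 0 1 (x i) := by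
  have hdet : 0 < R.det := hR.det_pos
  have hunit : IsUnit R.det := hdet.ne'.isUnit
  have hT : Rᵀ = R := hR.isHermitian
  have hquad : (R *ᵥ x) ⬝ᵥ ((R * R)⁻¹ *ᵥ (R *ᵥ x)) = x ⬝ᵥ x := by
    rw [mulVec_mulVec, Matrix.mul_inv_rev, Matrix.mul_assoc, Matrix.nonsing_inv_mul _ hunit,
      Matrix.mul_one, dotProduct_comm, dotProduct_mulVec, ← mulVec_transpose, mulVec_mulVec, hT,
      Matrix.mul_nonsing_inv _ hunit, one_mulVec]
  have hpow : (R * R).det ^ (-(1 : ℝ) / 2) = R.det⁻¹ := by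
    rw [det_mul, ← sq, ← Real.rpow_natCast, ← Real.rpow_mul hdet.le, ← Real.rpow_neg_one]
    norm_num
  rw [gaussianPdf, prod_gaussianPDFReal_eq, add_sub_cancel_left, hquad, hpow]
  ring

@[fun_prop]
lemma continuous_gaussianPdf {d : ℕ} (m : Fin d → ℝ) (S : Matrix (Fin d) (Fin d) ℝ) :
    Continuous (gaussianPdf m S) := by
  unfold gaussianPdf
  fun_prop

/-- Affine change of variables for the Lebesgue integral on `ℝ^d`. -/
lemma lintegral_comp_affine {d : ℕ} (m : Fin d → ℝ) {R : Matrix (Fin d) (Fin d) ℝ}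
    (hR : R.det ≠ 0) {F : (Fin d → ℝ) → ENNReal} (hF : Measurable F) :
    ∫⁻ x, F (m + R *ᵥ x) = ENNReal.ofReal |R.det⁻¹| * ∫⁻ y, F y := by
  have hmap := Real.map_matrix_volume_pi_eq_smul_volume_pi hR
  calc ∫⁻ x, F (m + R *ᵥ x)
      = ∫⁻ y, F (m + y) ∂(Measure.map (toLin' R) volume) := by
        rw [lintegral_map (by fun_prop) (by fun_prop)]
        simp
    _ = _ := by rw [hmap, lintegral_smul_measure, lintegral_add_left_eq_self, smul_eq_mul]

/-- `N(m, R²)` is the law of `m + R X` for a standard Gaussian vector `X`. -/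
lemma multivariateGaussian_mul_self {d : ℕ} (m : Fin d → ℝ) {R : Matrix (Fin d) (Fin d) ℝ}
    (hR : R.PosDef) :
    multivariateGaussian m (R * R) = (stdGaussianPi d).map fun x => m + R *ᵥ x := by
  have hdet : 0 < R.det := hR.det_pos
  have hmeas : Measurable fun x : Fin d → ℝ => m + R *ᵥ x := by fun_prop
  ext s hs
  rw [Measure.map_apply hmeas hs, stdGaussianPi_eq_withDensity, multivariateGaussian,
    withDensity_apply _ hs, withDensity_apply _ (hmeas hs), ← lintegral_indicator hs,
    ← lintegral_indicator (hmeas hs)]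
  have hP : Measurable (s.indicator fun y => ENNReal.ofReal (gaussianPdf m (R * R) y)) :=
    Measurable.indicator (by fun_prop) hs
  have hcv := lintegral_comp_affine m hdet.ne' hP
  have hpt : ∀ x, s.indicator (fun y => ENNReal.ofReal (gaussianPdf m (R * R) y)) (m + R *ᵥ x)
      = ENNReal.ofReal |R.det⁻¹| * ((fun x => m + R *ᵥ x) ⁻¹' s).indicator (fun x =>
        ENNReal.ofReal (∏ i, ProbabilityTheory.gaussianPDFReal 0 1 (x i))) x := by
    intro x
    by_cases hx : m + R *ᵥ x ∈ s
    · rw [Set.indicator_of_mem hx, Set.indicator_of_mem (by exact hx), gaussianPdf_affine m hR,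
        abs_of_pos (inv_pos.2 hdet), ENNReal.ofReal_mul (inv_pos.2 hdet).le]
    · rw [Set.indicator_of_notMem hx, Set.indicator_of_notMem (by exact hx), mul_zero]
  simp_rw [hpt] at hcv
  rw [lintegral_const_mul' _ _ ENNReal.ofReal_ne_top] at hcv
  exact ((ENNReal.mul_right_inj (by simpa using hdet.ne') ENNReal.ofReal_ne_top).1 hcv).symm

lemma memLp_two_eval_stdGaussianPi {d : ℕ} (i : Fin d) :
    MemLp (fun x : Fin d → ℝ => x i) 2 (stdGaussianPi d) :=
  (ProbabilityTheory.memLp_id_gaussianReal 2).comp_measurePreserving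
    (measurePreserving_eval (fun _ => ProbabilityTheory.gaussianReal 0 1) i)

lemma integral_eval_stdGaussianPi {d : ℕ} (i : Fin d) :
    ∫ x, x i ∂(stdGaussianPi d) = 0 := by
  rw [stdGaussianPi, integral_eval]
  exact ProbabilityTheory.integral_id_gaussianReal

lemma integrable_eval_mul_eval_stdGaussianPi {d : ℕ} (i j : Fin d) :
    Integrable (fun x : Fin d → ℝ => x i * x j) (stdGaussianPi d) :=
  (memLp_two_eval_stdGaussianPi i).integrable_mul (memLp_two_eval_stdGaussianPi j)

lemma integral_eval_mul_eval_stdGaussianPi {d : ℕ} (i j : Fin d) :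
    ∫ x, x i * x j ∂(stdGaussianPi d) = (1 : Matrix (Fin d) (Fin d) ℝ) i j := by
  by_cases hij : i = j
  · subst hij
    have h := ProbabilityTheory.variance_id_gaussianReal (μ := 0) (v := 1)
    rw [ProbabilityTheory.variance_of_integral_eq_zero aemeasurable_id
      (by simp)] at h
    rw [stdGaussianPi, integral_comp_eval (μ := fun _ => ProbabilityTheory.gaussianReal 0 1)
      (f := fun t => t * t) (by fun_prop)]
    simpa [sq] using h
  · have hind : ProbabilityTheory.IndepFun (fun x : Fin d → ℝ => x i) (fun x => x j)
        (stdGaussianPi d) :=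
      (ProbabilityTheory.iIndepFun_pi (X := fun _ => id) fun _ => aemeasurable_id).indepFun hij
    rw [hind.integral_fun_mul_eq_mul_integral
        (memLp_two_eval_stdGaussianPi i).aestronglyMeasurable
        (memLp_two_eval_stdGaussianPi j).aestronglyMeasurable,
      integral_eval_stdGaussianPi, zero_mul, Matrix.one_apply_ne hij]

/-- A quadratic polynomial is integrable for the standard Gaussian measure. -/
lemma integrable_quadratic_stdGaussianPi {d : ℕ} (c : ℝ) (b : Fin d → ℝ)
    (A : Matrix (Fin d) (Fin d) ℝ) :
    Integrable (fun x => c + b ⬝ᵥ x + x ⬝ᵥ (A *ᵥ x)) (stdGaussianPi d) := by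
  simp only [dotProduct, mulVec, Finset.mul_sum]
  refine ((integrable_const c).add (integrable_finsetSum _ fun i _ =>
    ((memLp_two_eval_stdGaussianPi i).integrable one_le_two).const_mul _)).add
    (integrable_finsetSum _ fun i _ => integrable_finsetSum _ fun j _ => ?_)
  exact ((integrable_eval_mul_eval_stdGaussianPi i j).const_mul (A i j)).congr
    (.of_forall fun x => mul_left_comm _ _ _)

lemma integral_quadratic_stdGaussianPi {d : ℕ} (c : ℝ) (b : Fin d → ℝ)
    (A : Matrix (Fin d) (Fin d) ℝ) :
    ∫ x, (c + b ⬝ᵥ x + x ⬝ᵥ (A *ᵥ x)) ∂(stdGaussianPi d) = c + A.trace := by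
  have hlin : ∀ i, Integrable (fun x : Fin d → ℝ => b i * x i) (stdGaussianPi d) :=
    fun i => ((memLp_two_eval_stdGaussianPi i).integrable one_le_two).const_mul _
  have hquad : ∀ i j, Integrable (fun x : Fin d → ℝ => A i j * (x i * x j)) (stdGaussianPi d) :=
    fun i j => (integrable_eval_mul_eval_stdGaussianPi i j).const_mul _
  have hrw : ∀ x : Fin d → ℝ, c + b ⬝ᵥ x + x ⬝ᵥ (A *ᵥ x)
      = c + ∑ i, b i * x i + ∑ i, ∑ j, A i j * (x i * x j) := by
    intro x
    simp only [dotProduct, mulVec, Finset.mul_sum]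
    congr 1
    exact Finset.sum_congr rfl fun i _ => Finset.sum_congr rfl fun j _ => by ring
  simp_rw [hrw]
  have hL : Integrable (fun x : Fin d → ℝ => ∑ i, b i * x i) (stdGaussianPi d) :=
    integrable_finsetSum _ fun i _ => hlin i
  have hcL : Integrable (fun x : Fin d → ℝ => c + ∑ i, b i * x i) (stdGaussianPi d) :=
    (integrable_const c).add hL
  have hQ : Integrable (fun x : Fin d → ℝ => ∑ i, ∑ j, A i j * (x i * x j)) (stdGaussianPi d) :=
    integrable_finsetSum _ fun i _ => integrable_finsetSum _ fun j _ => hquad i j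
  rw [integral_add hcL hQ, integral_add (integrable_const c) hL,
    integral_finsetSum _ fun i _ => hlin i,
    integral_finsetSum _ fun i _ => integrable_finsetSum _ fun j _ => hquad i j]
  simp_rw [integral_finsetSum _ fun j _ => hquad _ j, integral_const_mul,
    integral_eval_stdGaussianPi, integral_eval_mul_eval_stdGaussianPi]
  simp [Matrix.one_apply, Matrix.trace]

/-- Young's inequality for the quadratic form of a positive definite matrix and its inverse. -/
lemma two_mul_dotProduct_le {d : ℕ} {R : Matrix (Fin d) (Fin d) ℝ} (hR : R.PosDef)
    (x y : Fin d → ℝ) :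
    2 * (x ⬝ᵥ y) ≤ x ⬝ᵥ (R *ᵥ x) + y ⬝ᵥ (R⁻¹ *ᵥ y) := by
  have hT : Rᵀ = R := hR.isHermitian
  have h := hR.posSemidef.dotProduct_mulVec_nonneg (x - R⁻¹ *ᵥ y)
  have hRy : R *ᵥ (R⁻¹ *ᵥ y) = y := by
    rw [mulVec_mulVec, Matrix.mul_nonsing_inv _ hR.det_pos.ne'.isUnit, one_mulVec]
  have hsymm : (R⁻¹ *ᵥ y) ⬝ᵥ (R *ᵥ x) = x ⬝ᵥ y := by
    rw [dotProduct_mulVec, ← mulVec_transpose, hT, hRy, dotProduct_comm]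
  simp only [star_trivial, mulVec_sub, sub_dotProduct, dotProduct_sub, hRy, hsymm,
    dotProduct_comm (R⁻¹ *ᵥ y) y] at h
  linarith

lemma sqWasserstein_gaussian_le {d : ℕ} (m₁ m₂ : Fin d → ℝ) {R : Matrix (Fin d) (Fin d) ℝ}
    (hR : R.PosDef) :
    sqWasserstein (multivariateGaussian m₁ 1) (multivariateGaussian m₂ (R * R))
      ≤ ENNReal.ofReal (sqNorm (m₁ - m₂) + d + (R * R).trace - 2 * R.trace) := by
  have hT : Rᵀ = R := hR.isHermitian
  have hmeas : Measurable fun x : Fin d → ℝ => (m₁ + x, m₂ + R *ᵥ x) := by fun_prop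
  have hone := multivariateGaussian_mul_self m₁ (R := 1) PosDef.one
  simp only [mul_one, one_mulVec] at hone
  refine (iInf₂_le ((stdGaussianPi d).map fun x => (m₁ + x, m₂ + R *ᵥ x)) ⟨?_, ?_⟩).trans
    (le_of_eq ?_)
  rotate_left
  · rw [Measure.map_map measurable_fst hmeas, hone]
    rfl
  · rw [Measure.map_map measurable_snd hmeas, multivariateGaussian_mul_self m₂ hR]
    rfl
  have hcost : ∀ x, sqNorm (m₁ + x - (m₂ + R *ᵥ x)) = sqNorm (m₁ - m₂)
      + ((2 : ℝ) • ((1 - R) *ᵥ (m₁ - m₂))) ⬝ᵥ x + x ⬝ᵥ (((1 - R) * (1 - R)) *ᵥ x) := by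
    intro x
    have hT' : (1 - R)ᵀ = 1 - R := by rw [transpose_sub, transpose_one, hT]
    have hx : m₁ + x - (m₂ + R *ᵥ x) = (m₁ - m₂) + (1 - R) *ᵥ x := by
      rw [sub_mulVec, one_mulVec]
      abel
    have h1 : ((1 - R) *ᵥ (m₁ - m₂)) ⬝ᵥ x = (m₁ - m₂) ⬝ᵥ ((1 - R) *ᵥ x) := by
      rw [dotProduct_mulVec, ← mulVec_transpose, hT']
    have h2 : x ⬝ᵥ (((1 - R) * (1 - R)) *ᵥ x) = ((1 - R) *ᵥ x) ⬝ᵥ ((1 - R) *ᵥ x) := by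
      rw [← mulVec_mulVec, dotProduct_mulVec x, ← mulVec_transpose, hT']
    rw [hx, smul_dotProduct, h1, h2, sqNorm_eq_dotProduct, sqNorm_eq_dotProduct, add_dotProduct,
      dotProduct_add, dotProduct_add, dotProduct_comm ((1 - R) *ᵥ x) (m₁ - m₂), smul_eq_mul]
    ring
  have hint := integrable_quadratic_stdGaussianPi (sqNorm (m₁ - m₂))
    ((2 : ℝ) • ((1 - R) *ᵥ (m₁ - m₂))) ((1 - R) * (1 - R))
  rw [lintegral_map (by fun_prop) hmeas]
  simp only [hcost]
  rw [← ofReal_integral_eq_lintegral_ofReal hint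
    (.of_forall fun x => (sqNorm_nonneg _).trans_eq (hcost x)), integral_quadratic_stdGaussianPi]
  congr 1
  simp only [sub_mul, mul_sub, trace_sub, mul_one, one_mul, trace_one, Fintype.card_fin]
  ring

lemma le_sqWasserstein_gaussian {d : ℕ} (m₁ m₂ : Fin d → ℝ) {R : Matrix (Fin d) (Fin d) ℝ}
    (hR : R.PosDef) :
    ENNReal.ofReal (sqNorm (m₁ - m₂) + d + (R * R).trace - 2 * R.trace)
      ≤ sqWasserstein (multivariateGaussian m₁ 1) (multivariateGaussian m₂ (R * R)) := by
  have hT : Rᵀ = R := hR.isHermitian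
  have hone := multivariateGaussian_mul_self m₁ (R := 1) PosDef.one
  simp only [mul_one, one_mulVec] at hone
  have hRsq := multivariateGaussian_mul_self m₂ hR
  refine le_iInf₂ fun cpl hcpl => ?_
  obtain ⟨hfst, hsnd⟩ := hcpl
  by_cases htop : ∫⁻ q, ENNReal.ofReal (sqNorm (q.1 - q.2)) ∂cpl = ⊤
  · rw [htop]
    exact le_top
  have hcost : Integrable
      (fun q : (Fin d → ℝ) × (Fin d → ℝ) => sqNorm (q.1 - q.2)) cpl :=
    (lintegral_ofReal_ne_top_iff_integrable
      (Continuous.aestronglyMeasurable (by fun_prop))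
      (.of_forall fun _ => sqNorm_nonneg _)).1 htop
  rw [← ofReal_integral_eq_lintegral_ofReal hcost (.of_forall fun _ => sqNorm_nonneg _)]
  refine ENNReal.ofReal_le_ofReal ?_
  set a := m₁ - m₂ with ha
  let f : (Fin d → ℝ) → ℝ := fun x =>
    sqNorm a + ((2 : ℝ) • a) ⬝ᵥ (x - m₁) + (x - m₁) ⬝ᵥ ((1 - R) *ᵥ (x - m₁))
  let g : (Fin d → ℝ) → ℝ := fun y =>
    0 + ((-2 : ℝ) • a) ⬝ᵥ (y - m₂) + (y - m₂) ⬝ᵥ ((1 - R⁻¹) *ᵥ (y - m₂))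
  have hfc : Continuous f := by fun_prop
  have hgc : Continuous g := by fun_prop
  have hg : ∀ x, g (m₂ + R *ᵥ x)
      = 0 + (R *ᵥ ((-2 : ℝ) • a)) ⬝ᵥ x + x ⬝ᵥ ((R * R - R) *ᵥ x) := by
    intro x
    have h1 : R * R - R = R * ((1 - R⁻¹) * R) := by
      rw [sub_mul, Matrix.nonsing_inv_mul _ hR.det_pos.ne'.isUnit, mul_sub, one_mul, mul_one]
    simp only [g, add_sub_cancel_left]
    rw [h1, ← mulVec_mulVec, ← mulVec_mulVec, dotProduct_mulVec _ R, dotProduct_mulVec x R,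
      ← mulVec_transpose, ← mulVec_transpose, hT]
  have hfint : Integrable f (cpl.map Prod.fst) ∧
      ∫ x, f x ∂(cpl.map Prod.fst) = sqNorm a + (1 - R).trace := by
    rw [hfst, hone, integrable_map_measure (by fun_prop) (by fun_prop),
      integral_map (by fun_prop) (by fun_prop)]
    simp only [f, Function.comp_def, add_sub_cancel_left]
    exact ⟨integrable_quadratic_stdGaussianPi _ _ _, integral_quadratic_stdGaussianPi _ _ _⟩
  have hgint : Integrable g (cpl.map Prod.snd) ∧
      ∫ y, g y ∂(cpl.map Prod.snd) = 0 + (R * R - R).trace := by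
    rw [hsnd, hRsq, integrable_map_measure (by fun_prop) (by fun_prop),
      integral_map (by fun_prop) (by fun_prop)]
    simp only [Function.comp_def, hg]
    exact ⟨integrable_quadratic_stdGaussianPi _ _ _, integral_quadratic_stdGaussianPi _ _ _⟩
  rw [integrable_map_measure (by fun_prop) (by fun_prop),
    integral_map (by fun_prop) (by fun_prop)] at hfint hgint
  simp only [Function.comp_def] at hfint hgint
  have hle : ∀ q : (Fin d → ℝ) × (Fin d → ℝ), f q.1 + g q.2 ≤ sqNorm (q.1 - q.2) := by
    rintro ⟨x, y⟩
    have hxy : x - y = a + (x - m₁) - (y - m₂) := by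
      rw [ha]
      abel
    have hY := two_mul_dotProduct_le hR (x - m₁) (y - m₂)
    simp only [f, g]
    rw [hxy]
    generalize x - m₁ = u at *
    generalize y - m₂ = v at *
    simp only [sqNorm_eq_dotProduct, sub_mulVec, one_mulVec, dotProduct_sub, sub_dotProduct,
      dotProduct_add, add_dotProduct, smul_dotProduct, smul_eq_mul, dotProduct_comm v a,
      dotProduct_comm u a, dotProduct_comm v u]
    linarith
  calc sqNorm a + d + (R * R).trace - 2 * R.trace
      = ∫ q, (f q.1 + g q.2) ∂cpl := by
        rw [integral_add hfint.1 hgint.1, hfint.2, hgint.2]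
        simp only [trace_sub, trace_one, Fintype.card_fin]
        ring
    _ ≤ ∫ q, sqNorm (q.1 - q.2) ∂cpl := integral_mono (hfint.1.add hgint.1) hcost hle

/-- For means `m₁, m₂ ∈ ℝ^d` and symmetric positive definite `Σ`,
`W₂²(N(m₁, I_d), N(m₂, Σ)) = ‖m₁ − m₂‖₂² + d + Tr Σ − 2 Tr(Σ^{1/2})`, where
`Σ^{1/2}` is the unique symmetric positive definite square root `R` of `Σ`. -/
theorem stmt_13 (d : ℕ) (m₁ m₂ : Fin d → ℝ) (S : Matrix (Fin d) (Fin d) ℝ)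
    (hS : S.PosDef) (R : Matrix (Fin d) (Fin d) ℝ) (hR : R.PosDef) (hRsq : R * R = S) :
    sqWasserstein (multivariateGaussian m₁ (1 : Matrix (Fin d) (Fin d) ℝ))
        (multivariateGaussian m₂ S)
      = ENNReal.ofReal (sqNorm (m₁ - m₂) + d + S.trace - 2 * R.trace) := by
  subst hRsq
  exact le_antisymm (sqWasserstein_gaussian_le m₁ m₂ hR) (le_sqWasserstein_gaussian m₁ m₂ hR)
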